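/- Let α ∈ (0,1), δ₁ > 1, and suppose the bivariate Mittag-Leffler parameters satisfy the convergence conditions Δ₁ > 0, Δ₂ > 0. For f continuous on [0,T], define F(t) = ∫_0^t η^{δ₁-1} E₂(ω₁η^{α₃}, ω₂η^{β₂}) f(t-η) dη. Then the Caputo derivative D_t^α F(t) = ∫_0^t η^{δ₁-α-1} Ê₂(ω₁η^{α₃}, ω₂η^{β₂}) f(t-η) dη, where Ê₂ is the same bivariate Mittag-Leffler series with δ₁ replaced by δ₁ - α. -/

import Mathlib

open Real MeasureTheory

/-- Generalized Pochhammer symbol `(γ)_s = Γ(γ+s)/Γ(γ)`. -/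
noncomputable def genPoch (γ s : ℝ) : ℝ := Real.Gamma (γ + s) / Real.Gamma γ

/-- The bivariate Mittag-Leffler function of Definition 3. -/
noncomputable def E2 (γ₁ α₁ β₁ γ₂ α₂ δ₁ α₃ β₂ δ₂ α₄ δ₃ β₃ : ℝ) (x y : ℂ) : ℂ :=
  ∑' p : ℕ × ℕ,
    ((genPoch γ₁ (α₁ * p.1 + β₁ * p.2) * genPoch γ₂ (α₂ * p.1) : ℝ) : ℂ) *
        x ^ p.1 * y ^ p.2 /
      ((Real.Gamma (δ₁ + α₃ * p.1 + β₂ * p.2) * Real.Gamma (δ₂ + α₄ * p.1) *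
          Real.Gamma (δ₃ + β₃ * p.2) : ℝ) : ℂ)

/-- Caputo fractional derivative of order `α ∈ (0,1)` of a complex-valued function. -/
noncomputable def caputoC (α : ℝ) (F : ℝ → ℂ) (t : ℝ) : ℂ :=
  (1 / Real.Gamma (1 - α) : ℝ) • ∫ ξ in (0:ℝ)..t, ((t - ξ) ^ (-α) : ℝ) • deriv F ξ

/-- Upper Gamma bound. -/
lemma gamma_upper {a L N x : ℝ} (ha : 0 < a) (hL : 1 ≤ L) (hN : 0 < N) (hx : 0 ≤ x)
    (hxL : x ≤ L * N) :
    Real.Gamma (a + x) ≤ ((2:ℝ) ^ a * Real.Gamma a) * (((2 * L) ^ L) ^ N * N ^ x) := by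
  have hax : 0 < a + x := by linarith
  rw [Real.Gamma_eq_integral hax]
  have h1 := Real.integral_rpow_mul_exp_neg_mul_Ioi ha (by norm_num : (0:ℝ) < 1/2)
  have hi : IntegrableOn (fun t : ℝ => t ^ (a - 1) * Real.exp (-(1/2 * t))) (Set.Ioi 0) := by
    by_contra hc
    rw [integral_undef hc] at h1
    have : 0 < (1 / (1/2:ℝ)) ^ a * Real.Gamma a := by
      have := Real.Gamma_pos_of_pos ha
      positivity
    linarith
  have key : ∫ t in Set.Ioi (0:ℝ), Real.exp (-t) * t ^ (a + x - 1) ≤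
      ∫ t in Set.Ioi (0:ℝ), (((2 * L) ^ L) ^ N * N ^ x) * (t ^ (a - 1) * Real.exp (-(1/2 * t))) := by
    apply setIntegral_mono_on (Real.GammaIntegral_convergent hax) (hi.const_mul _) measurableSet_Ioi
    intro t ht
    have ht0 : 0 < t := ht
    have e1 : t ^ (a + x - 1) = t ^ (a - 1) * t ^ x := by
      rw [← Real.rpow_add ht0]; congr 1; ring
    have hle : t ≤ (2 * L * N) * Real.exp (t / (2 * L * N)) := by
      have h := Real.add_one_le_exp (t / (2 * L * N))
      have hp : 0 < 2 * L * N := by positivity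
      calc t = (2 * L * N) * (t / (2 * L * N)) := by field_simp
        _ ≤ _ := by gcongr; linarith
    have e2 : t ^ x ≤ (2 * L) ^ (L * N) * N ^ x * Real.exp (t / 2) := by
      calc t ^ x ≤ ((2 * L * N) * Real.exp (t / (2 * L * N))) ^ x := by gcongr
        _ = (2 * L) ^ x * N ^ x * Real.exp (t / (2 * L * N) * x) := by
            rw [Real.mul_rpow (by positivity) (by positivity),
              Real.mul_rpow (by positivity) (by positivity), ← Real.exp_mul]
        _ ≤ (2 * L) ^ (L * N) * N ^ x * Real.exp (t / 2) := by
            gcongr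
            · linarith
            · calc t / (2 * L * N) * x ≤ t / (2 * L * N) * (L * N) := by gcongr
                _ = t / 2 := by field_simp
    have e3 : Real.exp (-t) * Real.exp (t/2) = Real.exp (-(1/2 * t)) := by
      rw [← Real.exp_add]; congr 1; ring
    rw [e1, ← Real.rpow_mul (by positivity)]
    calc Real.exp (-t) * (t ^ (a - 1) * t ^ x)
        ≤ Real.exp (-t) * (t ^ (a - 1) * ((2 * L) ^ (L * N) * N ^ x * Real.exp (t / 2))) := by
          gcongr
      _ = (2 * L) ^ (L * N) * N ^ x * (t ^ (a-1) * (Real.exp (-t) * Real.exp (t/2))) := by ring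
      _ = _ := by rw [e3]
  refine key.trans (le_of_eq ?_)
  rw [integral_const_mul, h1]
  norm_num
  ring

/-- Lower Gamma bound. -/
lemma gamma_lower {a N x : ℝ} (ha : 0 < a) (hN : 1 ≤ N) (hx : 0 ≤ x) :
    (1/2) * (Real.exp (-2) ^ N * N ^ x) ≤ Real.Gamma (a + x) := by
  have hax : 0 < a + x := by linarith
  have hN0 : 0 < N := by linarith
  rw [Real.Gamma_eq_integral hax]
  have hsub : Set.Ioc N (2 * N) ⊆ Set.Ioi 0 := fun y hy => lt_trans hN0 hy.1
  calc (1/2) * (Real.exp (-2) ^ N * N ^ x)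
      = ∫ t in Set.Ioc N (2 * N), Real.exp (-2 * N) * (N ^ x * (2 * N)⁻¹) := by
        rw [setIntegral_const, ← Real.exp_mul]
        simp only [Measure.real, Real.volume_Ioc, smul_eq_mul]
        rw [ENNReal.toReal_ofReal (by linarith)]
        field_simp
        ring
    _ ≤ ∫ t in Set.Ioc N (2 * N), Real.exp (-t) * t ^ (a + x - 1) := by
        apply setIntegral_mono_on
        · exact integrableOn_const (by simp)
        · exact (Real.GammaIntegral_convergent hax).mono_set hsub
        · exact measurableSet_Ioc
        · intro t ht
          have ht0 : 0 < t := hsub ht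
          have ht1 : 1 ≤ t := hN.trans ht.1.le
          have e1 : t ^ (a + x - 1) = t ^ x * t ^ (a - 1) := by
            rw [← Real.rpow_add ht0]; congr 1; ring
          rw [e1]
          gcongr
          · linarith [ht.2]
          · exact ht.1.le
          · calc (2 * N)⁻¹ ≤ t⁻¹ := by gcongr; exact ht.2
              _ = t ^ (-1 : ℝ) := (Real.rpow_neg_one t).symm
              _ ≤ t ^ (a - 1) := Real.rpow_le_rpow_of_exponent_le ht1 (by linarith)
    _ ≤ ∫ t in Set.Ioi (0:ℝ), Real.exp (-t) * t ^ (a + x - 1) := by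
        apply setIntegral_mono_set (Real.GammaIntegral_convergent hax)
        · filter_upwards [self_mem_ae_restrict measurableSet_Ioi] with t ht
          have ht0 : (0:ℝ) < t := ht
          simp only [Pi.zero_apply]
          positivity
        · exact hsub.eventuallyLE
lemma real_beta {μ ν t : ℝ} (hμ : 0 < μ) (hν : 0 < ν) (ht : 0 < t) :
    ∫ u in (0:ℝ)..t, u ^ (μ - 1) * (t - u) ^ (ν - 1) =
      t ^ (μ + ν - 1) * (Real.Gamma μ * Real.Gamma ν / Real.Gamma (μ + ν)) := by
  have h := Complex.betaIntegral_scaled (μ : ℂ) (ν : ℂ) ht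
  have h2 := Complex.Gamma_mul_Gamma_eq_betaIntegral (s := (μ:ℂ)) (t := (ν:ℂ)) (by simpa) (by simpa)
  have hg : Real.Gamma (μ + ν) ≠ 0 := (Real.Gamma_pos_of_pos (by linarith)).ne'
  rw [← Complex.ofReal_add, Complex.Gamma_ofReal, Complex.Gamma_ofReal, Complex.Gamma_ofReal] at h2
  have h3 : Complex.betaIntegral μ ν =
      ((Real.Gamma μ * Real.Gamma ν / Real.Gamma (μ + ν) : ℝ) : ℂ) := by
    have : ((Real.Gamma (μ + ν) : ℝ) : ℂ) ≠ 0 := by exact_mod_cast hg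
    push_cast
    field_simp
    rw [h2]
    try ring
  rw [h3] at h
  apply Complex.ofReal_injective
  rw [← intervalIntegral.integral_ofReal]
  rw [Complex.ofReal_mul, Complex.ofReal_cpow ht.le]
  push_cast at h ⊢
  rw [← h]
  apply intervalIntegral.integral_congr
  intro u hu
  rw [Set.uIcc_of_le ht.le] at hu
  simp only
  rw [Complex.ofReal_cpow hu.1, Complex.ofReal_cpow (sub_nonneg.2 hu.2)]
  push_cast
  rfl

lemma real_beta_integrable {μ ν t : ℝ} (hμ : 0 < μ) (hν : 0 < ν) (ht : 0 < t) :
    IntervalIntegrable (fun u => u ^ (μ - 1) * (t - u) ^ (ν - 1)) volume 0 t := by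
  apply intervalIntegral.intervalIntegrable_of_integral_ne_zero
  rw [real_beta hμ hν ht]
  have := Real.Gamma_pos_of_pos hμ
  have := Real.Gamma_pos_of_pos hν
  have := Real.Gamma_pos_of_pos (add_pos hμ hν)
  positivity

/-- Abstract kernel. -/
noncomputable def KK {ι : Type} (c : ι → ℂ) (r : ι → ℝ) (δ η : ℝ) : ℂ :=
  ∑' i, c i * ((η ^ (δ + r i - 1) / Real.Gamma (δ + r i) : ℝ) : ℂ)

lemma KK_frac {ι : Type} [Countable ι] (c : ι → ℂ) (r : ι → ℝ) (hr : ∀ i, 0 ≤ r i)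
    (hS : ∀ δ > 0, ∀ t > 0, Summable fun i => ‖c i‖ * (t ^ (r i) / Real.Gamma (δ + r i)))
    {δ μ t : ℝ} (hδ : 0 < δ) (hμ : 0 < μ) (ht : 0 < t) :
    ∫ u in (0:ℝ)..t, ((u ^ (μ - 1) : ℝ) : ℂ) * KK c r δ (t - u) =
      (Real.Gamma μ : ℂ) * KK c r (δ + μ) t := by
  have hd : ∀ i, 0 < δ + r i := fun i => by linarith [hr i]
  have hgd : ∀ i, 0 < Real.Gamma (δ + r i) := fun i => Real.Gamma_pos_of_pos (hd i)
  have hgm := Real.Gamma_pos_of_pos hμ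
  have hint : ∀ i, ∫ u in (0:ℝ)..t, u ^ (μ - 1) * (t - u) ^ (δ + r i - 1) =
      t ^ (μ + (δ + r i) - 1) * (Real.Gamma μ * Real.Gamma (δ + r i) / Real.Gamma (μ + (δ + r i))) :=
    fun i => real_beta hμ (hd i) ht
  have hii := fun i => real_beta_integrable hμ (hd i) ht
  simp_rw [intervalIntegrable_iff_integrableOn_Ioc_of_le ht.le] at hii
  simp_rw [intervalIntegral.integral_of_le ht.le] at hint ⊢
  let F : ι → ℝ → ℂ := fun i u => (c i * ((1 / Real.Gamma (δ + r i) : ℝ) : ℂ)) *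
    ((u ^ (μ - 1) * (t - u) ^ (δ + r i - 1) : ℝ) : ℂ)
  have hFint : ∀ i, Integrable (F i) (volume.restrict (Set.Ioc 0 t)) := fun i =>
    ((hii i).ofReal).const_mul _
  have hFn : ∀ i, ∫ u in Set.Ioc 0 t, ‖F i u‖ =
      (Real.Gamma μ * t ^ (δ + μ - 1)) * (‖c i‖ * (t ^ (r i) / Real.Gamma ((δ + μ) + r i))) := by
    intro i
    have : ∫ u in Set.Ioc 0 t, ‖F i u‖ = ∫ u in Set.Ioc 0 t,
        (‖c i‖ * (1 / Real.Gamma (δ + r i))) * (u ^ (μ - 1) * (t - u) ^ (δ + r i - 1)) := by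
      apply setIntegral_congr_fun measurableSet_Ioc
      intro u hu
      have h1 : 0 ≤ t - u := sub_nonneg.2 hu.2
      have h2 : 0 ≤ u := hu.1.le
      have := hgd i
      simp only [F, norm_mul, Complex.norm_real]
      rw [Real.norm_of_nonneg (by positivity), Real.norm_of_nonneg (by positivity),
        Real.norm_of_nonneg (by positivity)]
    rw [this, integral_const_mul, hint,
      show μ + (δ + r i) - 1 = (δ + μ - 1) + r i by ring, Real.rpow_add ht,
      show μ + (δ + r i) = δ + μ + r i by ring]
    have := (hgd i).ne'
    field_simp
  have hs := hasSum_integral_of_summable_integral_norm hFint (by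
    simp_rw [hFn]
    exact (hS (δ + μ) (by linarith) t ht).mul_left _)
  have e1 : ∫ u in Set.Ioc 0 t, ((u ^ (μ - 1) : ℝ) : ℂ) * KK c r δ (t - u) =
      ∫ u in Set.Ioc 0 t, ∑' i, F i u := by
    congr 1
    ext u
    rw [KK, ← tsum_mul_left]
    congr 1
    ext i
    simp only [F]
    push_cast
    ring
  rw [e1, ← hs.tsum_eq, KK, ← tsum_mul_left]
  congr 1
  ext i
  simp only [F]
  rw [integral_const_mul, integral_complex_ofReal, hint,
      show μ + (δ + r i) - 1 = δ + μ + r i - 1 by ring,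
      show μ + (δ + r i) = δ + μ + r i by ring]
  have : ((Real.Gamma (δ + r i) : ℝ) : ℂ) ≠ 0 := by exact_mod_cast (hgd i).ne'
  push_cast
  field_simp

lemma KK_integrable {ι : Type} [Countable ι] (c : ι → ℂ) (r : ι → ℝ) (hr : ∀ i, 0 ≤ r i)
    (hS : ∀ δ > 0, ∀ t > 0, Summable fun i => ‖c i‖ * (t ^ (r i) / Real.Gamma (δ + r i)))
    {δ T : ℝ} (hδ : 0 < δ) (hT : 0 < T) :
    IntegrableOn (KK c r δ) (Set.Ioc 0 T) := by
  have hd : ∀ i, 0 < δ + r i := fun i => by linarith [hr i]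
  have hgd : ∀ i, 0 < Real.Gamma (δ + r i) := fun i => Real.Gamma_pos_of_pos (hd i)
  have hm : Measurable (KK c r δ) := by
    unfold KK
    apply Measurable.tsum
    intro i
    fun_prop
  have hp : IntegrableOn (fun x : ℝ => x ^ (δ - 1)) (Set.Ioc 0 T) := by
    rw [← intervalIntegrable_iff_integrableOn_Ioc_of_le hT.le]
    exact intervalIntegral.intervalIntegrable_rpow' (by linarith)
  refine Integrable.mono' (hp.mul_const (∑' i, ‖c i‖ * (T ^ (r i) / Real.Gamma (δ + r i))))
    hm.aestronglyMeasurable ?_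
  filter_upwards [self_mem_ae_restrict measurableSet_Ioc] with x hx
  have hx0 : 0 < x := hx.1
  rw [← tsum_mul_left]
  unfold KK
  apply tsum_of_norm_bounded ((hS δ hδ T hT).mul_left _).hasSum
  intro i
  have := hgd i
  rw [norm_mul, Complex.norm_real, Real.norm_of_nonneg (by positivity),
    show δ + r i - 1 = (δ - 1) + r i by ring, Real.rpow_add hx0]
  calc ‖c i‖ * (x ^ (δ - 1) * x ^ r i / Real.Gamma (δ + r i))
      = x ^ (δ - 1) * (‖c i‖ * (x ^ r i / Real.Gamma (δ + r i))) := by ring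
    _ ≤ _ := by
      gcongr
      · exact hr i
      · exact hx.2
lemma conv_trunc (a b : ℝ → ℂ) {T x : ℝ} (hx : x ≤ T) :
    convolution (Set.indicator (Set.Ioc 0 T) a) (Set.indicator (Set.Ioc 0 T) b)
      (ContinuousLinearMap.mul ℝ ℂ) volume x = ∫ u in Set.Ioc 0 x, a u * b (x - u) := by
  rw [convolution_def, integral_Ioc_eq_integral_Ioo, ← integral_indicator measurableSet_Ioo]
  congr 1
  ext u
  simp only [ContinuousLinearMap.mul_apply']
  by_cases h : u ∈ Set.Ioo 0 x
  · rw [Set.indicator_of_mem h, Set.indicator_of_mem, Set.indicator_of_mem]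
    · exact ⟨by linarith [h.2], by linarith [h.1]⟩
    · exact ⟨h.1, by linarith [h.2]⟩
  · rw [Set.indicator_of_notMem h]
    by_cases h1 : u ∈ Set.Ioc 0 T
    · rw [Set.indicator_of_notMem (a := x - u), mul_zero]
      intro h2
      exact h ⟨h1.1, by linarith [h2.1]⟩
    · rw [Set.indicator_of_notMem h1, zero_mul]

lemma conv_assoc_trunc (a b f : ℝ → ℂ) {T t : ℝ} (htT : t ≤ T)
    (ha : IntegrableOn a (Set.Ioc 0 T)) (hb : IntegrableOn b (Set.Ioc 0 T))
    (hf : IntegrableOn f (Set.Ioc 0 T)) (C : ℝ) (hC : ∀ x ∈ Set.Ioc 0 T, ‖f x‖ ≤ C) (hC0 : 0 ≤ C) :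
    ∫ s in Set.Ioc 0 t, (∫ u in Set.Ioc 0 s, a u * b (s - u)) * f (t - s) =
    ∫ s in Set.Ioc 0 t, a s * (∫ u in Set.Ioc 0 (t - s), b u * f (t - s - u)) := by
  set A := Set.indicator (Set.Ioc 0 T) a with hA
  set B := Set.indicator (Set.Ioc 0 T) b with hB
  set F := Set.indicator (Set.Ioc 0 T) f with hF
  have iA : Integrable A := (integrable_indicator_iff measurableSet_Ioc).2 ha
  have iB : Integrable B := (integrable_indicator_iff measurableSet_Ioc).2 hb
  have iF : Integrable F := (integrable_indicator_iff measurableSet_Ioc).2 hf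
  have bF : ∀ x, ‖F x‖ ≤ C := by
    intro x
    by_cases h : x ∈ Set.Ioc 0 T
    · rw [hF, Set.indicator_of_mem h]; exact hC x h
    · rw [hF, Set.indicator_of_notMem h]; simpa
  have hsub : ∀ x : ℝ, MeasurePreserving (fun s : ℝ => x - s) volume volume :=
    fun x => Measure.measurePreserving_sub_left volume x
  have main := convolution_assoc (μ := (volume : Measure ℝ)) (ν := (volume : Measure ℝ))
    (f := A) (g := B) (k := F)
    (ContinuousLinearMap.mul ℝ ℂ) (ContinuousLinearMap.mul ℝ ℂ)
    (ContinuousLinearMap.mul ℝ ℂ) (ContinuousLinearMap.mul ℝ ℂ) (x₀ := t)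
    (fun x y z => by simp [mul_assoc]) iA.1 iB.1 iF.1
    (iA.ae_convolution_exists _ iB) (iB.norm.ae_convolution_exists _ iF.norm) (by
      have iBF : Integrable (convolution (fun x => ‖B x‖) (fun x => ‖F x‖)
          (ContinuousLinearMap.mul ℝ ℝ) volume) := iB.norm.integrable_convolution _ iF.norm
      unfold ConvolutionExistsAt
      simp only [ContinuousLinearMap.mul_apply']
      refine Integrable.mul_bdd (c := (∫ x, ‖B x‖) * C) iA.norm
        (iBF.1.comp_measurePreserving (hsub t)) ?_
      refine Filter.Eventually.of_forall fun x => ?_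
      rw [convolution_def]
      refine (norm_integral_le_integral_norm _).trans ?_
      rw [← integral_mul_const]
      refine integral_mono_of_nonneg (Filter.Eventually.of_forall fun _ => norm_nonneg _)
        (iB.norm.mul_const _) (Filter.Eventually.of_forall fun y => ?_)
      simp only [ContinuousLinearMap.mul_apply', norm_mul, norm_norm]
      gcongr
      exact bF _)
  rw [convolution_def, convolution_def] at main
  simp only [ContinuousLinearMap.mul_apply'] at main
  have L : ∫ s in Set.Ioc 0 t, (∫ u in Set.Ioc 0 s, a u * b (s - u)) * f (t - s) =
      ∫ s, convolution A B (ContinuousLinearMap.mul ℝ ℂ) volume s * F (t - s) := by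
    rw [integral_Ioc_eq_integral_Ioo, ← integral_indicator measurableSet_Ioo]
    congr 1
    ext s
    by_cases h : s ∈ Set.Ioo 0 t
    · rw [Set.indicator_of_mem h, conv_trunc a b (h.2.le.trans htT), hF, Set.indicator_of_mem]
      exact ⟨by linarith [h.2], by linarith [h.1]⟩
    · rw [Set.indicator_of_notMem h]
      by_cases h1 : t - s ∈ Set.Ioc 0 T
      · have hs : s ≤ 0 := by
          by_contra hc
          exact h ⟨not_le.1 hc, by linarith [h1.1]⟩
        rw [conv_trunc a b (by linarith [h1.1]), Set.Ioc_eq_empty (by linarith)]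
        simp
      · rw [hF, Set.indicator_of_notMem h1, mul_zero]
  have R : ∫ s in Set.Ioc 0 t, a s * (∫ u in Set.Ioc 0 (t - s), b u * f (t - s - u)) =
      ∫ s, A s * convolution B F (ContinuousLinearMap.mul ℝ ℂ) volume (t - s) := by
    rw [← integral_indicator measurableSet_Ioc]
    congr 1
    ext s
    by_cases h : s ∈ Set.Ioc 0 t
    · rw [Set.indicator_of_mem h, conv_trunc b f (by linarith [h.1]), hA, Set.indicator_of_mem]
      exact ⟨h.1, h.2.trans htT⟩
    · rw [Set.indicator_of_notMem h]
      by_cases h1 : s ∈ Set.Ioc 0 T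
      · have hs : t - s < 0 := by
          by_contra hc
          exact h ⟨h1.1, by linarith⟩
        rw [conv_trunc b f (by linarith [h1.1]), Set.Ioc_eq_empty (by linarith)]
        simp
      · rw [hA, Set.indicator_of_notMem h1, zero_mul]
  rw [L, R, main]

lemma conv_integrable_trunc (b f : ℝ → ℂ) {T : ℝ}
    (hb : IntegrableOn b (Set.Ioc 0 T)) (hf : IntegrableOn f (Set.Ioc 0 T)) :
    IntegrableOn (fun s => ∫ u in Set.Ioc 0 s, b u * f (s - u)) (Set.Ioc 0 T) := by
  have iB := (integrable_indicator_iff measurableSet_Ioc).2 hb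
  have iF := (integrable_indicator_iff measurableSet_Ioc).2 hf
  have h := iB.integrable_convolution (ContinuousLinearMap.mul ℝ ℂ) iF
  refine (h.integrableOn (s := Set.Ioc 0 T)).congr_fun (fun x hx => ?_) measurableSet_Ioc
  exact conv_trunc b f hx.2

lemma conv_KK {ι : Type} [Countable ι] (c : ι → ℂ) (r : ι → ℝ) (hr : ∀ i, 0 ≤ r i)
    (hS : ∀ δ > 0, ∀ t > 0, Summable fun i => ‖c i‖ * (t ^ (r i) / Real.Gamma (δ + r i)))
    {δ μ t T : ℝ} (hδ : 0 < δ) (hμ : 0 < μ) (ht : 0 < t) (htT : t ≤ T)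
    (f : ℝ → ℂ) (hf : IntegrableOn f (Set.Ioc 0 T)) (C : ℝ)
    (hC : ∀ x ∈ Set.Ioc 0 T, ‖f x‖ ≤ C) (hC0 : 0 ≤ C) :
    ∫ ξ in (0:ℝ)..t, (((t - ξ) ^ (μ - 1) : ℝ) : ℂ) *
        (∫ u in Set.Ioc 0 ξ, KK c r δ u * f (ξ - u)) =
      (Real.Gamma μ : ℂ) * ∫ u in (0:ℝ)..t, KK c r (δ + μ) u * f (t - u) := by
  have hT : 0 < T := ht.trans_le htT
  have hp : IntegrableOn (fun x : ℝ => ((x ^ (μ - 1) : ℝ) : ℂ)) (Set.Ioc 0 T) := by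
    refine Integrable.ofReal ?_
    change IntegrableOn (fun x : ℝ => x ^ (μ - 1)) (Set.Ioc 0 T)
    rw [← intervalIntegrable_iff_integrableOn_Ioc_of_le hT.le]
    exact intervalIntegral.intervalIntegrable_rpow' (by linarith)
  have h := conv_assoc_trunc (fun x : ℝ => ((x ^ (μ - 1) : ℝ) : ℂ)) (KK c r δ) f htT hp
    (KK_integrable c r hr hS hδ hT) hf C hC hC0
  have e := intervalIntegral.integral_comp_sub_left (a := 0) (b := t)
    (fun ξ => (((t - ξ) ^ (μ - 1) : ℝ) : ℂ) * (∫ u in Set.Ioc 0 ξ, KK c r δ u * f (ξ - u))) t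
  simp only [sub_sub_cancel, sub_self, sub_zero] at e
  rw [← e, intervalIntegral.integral_of_le ht.le, ← h, ← intervalIntegral.integral_const_mul,
    intervalIntegral.integral_of_le ht.le]
  apply setIntegral_congr_fun measurableSet_Ioc
  intro s hs
  simp only
  rw [← intervalIntegral.integral_of_le hs.1.le, KK_frac c r hr hS hδ hμ hs.1]
  ring
lemma E2_summable (γ₁ α₁ β₁ γ₂ α₂ α₃ β₂ δ₂ α₄ δ₃ β₃ : ℝ)
    (hγ₁ : 0 < γ₁) (hγ₂ : 0 < γ₂) (hδ₂ : 0 < δ₂) (hδ₃ : 0 < δ₃)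
    (hα₁ : 0 < α₁) (hα₂ : 0 ≤ α₂) (hα₃ : 0 < α₃) (hα₄ : 0 < α₄)
    (hβ₁ : 0 < β₁) (hβ₂ : 0 < β₂) (hβ₃ : 0 < β₃)
    (hΔ₁ : 0 < α₃ + α₄ - α₁ - α₂) (hΔ₂ : 0 < β₂ + β₃ - β₁)
    {δ X Y : ℝ} (hδ : 0 < δ) (hX : 0 ≤ X) (hY : 0 ≤ Y) :
    Summable fun p : ℕ × ℕ =>
      genPoch γ₁ (α₁ * p.1 + β₁ * p.2) * genPoch γ₂ (α₂ * p.1) * X ^ p.1 * Y ^ p.2 /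
      (Real.Gamma (δ + (α₃ * p.1 + β₂ * p.2)) * Real.Gamma (δ₂ + α₄ * p.1) *
          Real.Gamma (δ₃ + β₃ * p.2)) := by
  have g1 := Real.Gamma_pos_of_pos hγ₁
  have g2 := Real.Gamma_pos_of_pos hγ₂
  set L : ℝ := 1 + α₁ + β₁ + α₂ with hL
  have hL1 : 1 ≤ L := by linarith
  set M : ℝ := (2 * L) ^ L with hM
  have hM0 : 0 < M := by positivity
  set κ : ℝ := Real.exp (-2) with hκ
  have hκ0 : 0 < κ := Real.exp_pos _
  set Q : ℝ := M * M / (κ * κ * κ) with hQ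
  have hQ0 : 0 < Q := by positivity
  have t1 : Filter.Tendsto (fun N : ℕ => Q * X * (N:ℝ) ^ (-(α₃ + α₄ - α₁ - α₂))) Filter.atTop
      (nhds (Q * X * 0)) :=
    ((tendsto_rpow_neg_atTop hΔ₁).comp tendsto_natCast_atTop_atTop).const_mul _
  have t2 : Filter.Tendsto (fun N : ℕ => Q * Y * (N:ℝ) ^ (-(β₂ + β₃ - β₁))) Filter.atTop
      (nhds (Q * Y * 0)) :=
    ((tendsto_rpow_neg_atTop hΔ₂).comp tendsto_natCast_atTop_atTop).const_mul _
  rw [mul_zero] at t1 t2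
  have ev := (t1.eventually (eventually_le_nhds (by norm_num : (0:ℝ) < 1/2))).and
    ((t2.eventually (eventually_le_nhds (by norm_num : (0:ℝ) < 1/2))).and
      (Filter.eventually_ge_atTop 1))
  obtain ⟨N0, hN0⟩ := Filter.eventually_atTop.1 ev
  set C : ℝ := (2:ℝ) ^ γ₁ * (2:ℝ) ^ γ₂ * 8 with hCdef
  have hsum : Summable fun p : ℕ × ℕ => C * ((1/2:ℝ) ^ p.1 * (1/2:ℝ) ^ p.2) := by
    apply Summable.mul_left
    have hg : Summable fun n : ℕ => (1/2:ℝ) ^ n :=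
      summable_geometric_of_lt_one (by norm_num) (by norm_num)
    exact hg.mul_of_nonneg hg (fun _ => by positivity) (fun _ => by positivity)
  refine Summable.of_norm_bounded_eventually hsum ?_
  have hfin : (Set.Iic N0 ×ˢ Set.Iic N0 : Set (ℕ × ℕ)).Finite :=
    (Set.finite_Iic N0).prod (Set.finite_Iic N0)
  filter_upwards [hfin.compl_mem_cofinite] with p hp
  obtain ⟨m, n⟩ := p
  have hmn : N0 ≤ m + n := by
    by_contra hc
    exact hp ⟨by simp only [Set.mem_Iic]; omega, by simp only [Set.mem_Iic]; omega⟩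
  obtain ⟨b1, b2, b3⟩ := hN0 (m + n) hmn
  simp only
  set N : ℝ := ((m + n : ℕ) : ℝ) with hN
  have hN1 : (1:ℝ) ≤ N := by rw [hN]; exact_mod_cast b3
  have hNp : 0 < N := by linarith
  have hm0 : (0:ℝ) ≤ m := Nat.cast_nonneg m
  have hn0 : (0:ℝ) ≤ n := Nat.cast_nonneg n
  have hNmn : N = m + n := by rw [hN]; push_cast; rfl
  have u1 := gamma_upper (a := γ₁) (L := L) (N := N) (x := α₁ * m + β₁ * n) hγ₁ hL1 hNp
    (by positivity) (by
      rw [hNmn, hL]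
      nlinarith [mul_nonneg hα₁.le hn0, mul_nonneg hβ₁.le hm0,
        mul_nonneg hα₂ hn0, mul_nonneg hα₂ hm0])
  have u2 := gamma_upper (a := γ₂) (L := L) (N := N) (x := α₂ * m) hγ₂ hL1 hNp
    (by positivity) (by
      rw [hNmn, hL]
      nlinarith [mul_nonneg hα₁.le hn0, mul_nonneg hβ₁.le hm0,
        mul_nonneg hα₂ hn0, mul_nonneg hα₁.le hm0, mul_nonneg hβ₁.le hn0])
  have l1 := gamma_lower (a := δ) (N := N) (x := α₃ * m + β₂ * n) hδ hN1 (by positivity)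
  have l2 := gamma_lower (a := δ₂) (N := N) (x := α₄ * m) hδ₂ hN1 (by positivity)
  have l3 := gamma_lower (a := δ₃) (N := N) (x := β₃ * n) hδ₃ hN1 (by positivity)
  rw [← hM] at u1 u2
  rw [← hκ] at l1 l2 l3
  have p1 : genPoch γ₁ (α₁ * m + β₁ * n) ≤ (2:ℝ) ^ γ₁ * (M ^ N * N ^ (α₁ * m + β₁ * n)) := by
    unfold genPoch
    rw [div_le_iff₀ g1]
    linarith
  have p2 : genPoch γ₂ (α₂ * m) ≤ (2:ℝ) ^ γ₂ * (M ^ N * N ^ (α₂ * m)) := by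
    unfold genPoch
    rw [div_le_iff₀ g2]
    linarith
  have q1 : 0 < Real.Gamma (γ₁ + (α₁ * m + β₁ * n)) := Real.Gamma_pos_of_pos (by positivity)
  have q2 : 0 < Real.Gamma (γ₂ + (α₂ * m)) := Real.Gamma_pos_of_pos (by positivity)
  have q3 : 0 < Real.Gamma (δ + (α₃ * m + β₂ * n)) := Real.Gamma_pos_of_pos (by positivity)
  have q4 : 0 < Real.Gamma (δ₂ + α₄ * m) := Real.Gamma_pos_of_pos (by positivity)
  have q5 : 0 < Real.Gamma (δ₃ + β₃ * n) := Real.Gamma_pos_of_pos (by positivity)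
  have p10 : 0 ≤ genPoch γ₁ (α₁ * m + β₁ * n) := by unfold genPoch; positivity
  have p20 : 0 ≤ genPoch γ₂ (α₂ * m) := by unfold genPoch; positivity
  rw [Real.norm_of_nonneg (by positivity)]
  have hpow : ∀ (x : ℝ) (k : ℕ), N ^ (x * k) = (N ^ x) ^ k := fun x k => by
    rw [Real.rpow_mul hNp.le, Real.rpow_natCast]
  have hMN : ∀ z : ℝ, 0 < z → z ^ N = z ^ m * z ^ n := fun z hz => by
    rw [hN, Real.rpow_natCast, pow_add]
  calc genPoch γ₁ (α₁ * m + β₁ * n) * genPoch γ₂ (α₂ * m) * X ^ m * Y ^ n /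
      (Real.Gamma (δ + (α₃ * m + β₂ * n)) * Real.Gamma (δ₂ + α₄ * m) * Real.Gamma (δ₃ + β₃ * n))
      ≤ ((2:ℝ) ^ γ₁ * (M ^ N * N ^ (α₁ * m + β₁ * n))) * ((2:ℝ) ^ γ₂ * (M ^ N * N ^ (α₂ * m)))
          * X ^ m * Y ^ n /
        (((1/2) * (κ ^ N * N ^ (α₃ * m + β₂ * n))) * ((1/2) * (κ ^ N * N ^ (α₄ * m))) *
          ((1/2) * (κ ^ N * N ^ (β₃ * n)))) := by
        gcongr
    _ = C * ((Q * X * N ^ (-(α₃ + α₄ - α₁ - α₂))) ^ m * (Q * Y * N ^ (-(β₂ + β₃ - β₁))) ^ n) := by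
        rw [show -(α₃ + α₄ - α₁ - α₂) = α₁ + α₂ - α₃ - α₄ by ring,
          show -(β₂ + β₃ - β₁) = β₁ - β₂ - β₃ by ring]
        simp only [Real.rpow_add hNp, Real.rpow_sub hNp, hpow, hMN _ hM0, hMN _ hκ0]
        rw [hCdef, hQ]
        have z1 : 0 < N ^ α₃ := by positivity
        have z2 : 0 < N ^ α₄ := by positivity
        have z3 : 0 < N ^ β₂ := by positivity
        have z4 : 0 < N ^ β₃ := by positivity
        simp only [div_pow, mul_pow]
        field_simp
        ring
    _ ≤ C * ((1/2:ℝ) ^ m * (1/2:ℝ) ^ n) := by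
        gcongr
theorem caputo_E2_convolution (γ₁ α₁ β₁ γ₂ α₂ δ₁ α₃ β₂ δ₂ α₄ δ₃ β₃ α T : ℝ)
    (hα : 0 < α) (hα1 : α < 1) (hδ : 1 < δ₁) (hT : 0 < T)
    (hγ₁ : 0 < γ₁) (hγ₂ : 0 < γ₂) (hδ₂ : 0 < δ₂) (hδ₃ : 0 < δ₃)
    (hα₁ : 0 < α₁) (hα₂ : 0 ≤ α₂) (hα₃ : 0 < α₃) (hα₄ : 0 < α₄)
    (hβ₁ : 0 < β₁) (hβ₂ : 0 < β₂) (hβ₃ : 0 < β₃)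
    (hΔ₁ : 0 < α₃ + α₄ - α₁ - α₂) (hΔ₂ : 0 < β₂ + β₃ - β₁)
    (ω₁ ω₂ : ℂ) (f : ℝ → ℝ) (hf : ContinuousOn f (Set.Icc 0 T))
    (t : ℝ) (ht : 0 < t) (htT : t ≤ T) :
    caputoC α (fun s => ∫ η in (0:ℝ)..s, ((η ^ (δ₁ - 1) : ℝ) : ℂ) *
        E2 γ₁ α₁ β₁ γ₂ α₂ δ₁ α₃ β₂ δ₂ α₄ δ₃ β₃
          (ω₁ * ((η ^ α₃ : ℝ) : ℂ)) (ω₂ * ((η ^ β₂ : ℝ) : ℂ)) *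
        ((f (s - η) : ℝ) : ℂ)) t =
      ∫ η in (0:ℝ)..t, ((η ^ (δ₁ - α - 1) : ℝ) : ℂ) *
        E2 γ₁ α₁ β₁ γ₂ α₂ (δ₁ - α) α₃ β₂ δ₂ α₄ δ₃ β₃
          (ω₁ * ((η ^ α₃ : ℝ) : ℂ)) (ω₂ * ((η ^ β₂ : ℝ) : ℂ)) *
        ((f (t - η) : ℝ) : ℂ) := by
  set c : ℕ × ℕ → ℂ := fun p =>
    ((genPoch γ₁ (α₁ * p.1 + β₁ * p.2) * genPoch γ₂ (α₂ * p.1) : ℝ) : ℂ) *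
        ω₁ ^ p.1 * ω₂ ^ p.2 /
      ((Real.Gamma (δ₂ + α₄ * p.1) * Real.Gamma (δ₃ + β₃ * p.2) : ℝ) : ℂ) with hc
  set r : ℕ × ℕ → ℝ := fun p => α₃ * p.1 + β₂ * p.2 with hrdef
  have hr : ∀ i, 0 ≤ r i := fun i => by simp only [hrdef]; positivity
  have hS : ∀ δ > 0, ∀ t > 0,
      Summable fun i => ‖c i‖ * (t ^ (r i) / Real.Gamma (δ + r i)) := by
    intro δ hδ t ht
    refine (E2_summable γ₁ α₁ β₁ γ₂ α₂ α₃ β₂ δ₂ α₄ δ₃ β₃ hγ₁ hγ₂ hδ₂ hδ₃ hα₁ hα₂ hα₃ hα₄ hβ₁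
      hβ₂ hβ₃ hΔ₁ hΔ₂ (δ := δ) (X := ‖ω₁‖ * t ^ α₃) (Y := ‖ω₂‖ * t ^ β₂) hδ (by positivity)
      (by positivity)).congr ?_
    intro p
    have g1 := Real.Gamma_pos_of_pos hγ₁
    have g2 := Real.Gamma_pos_of_pos hγ₂
    have q1 : 0 < Real.Gamma (γ₁ + (α₁ * p.1 + β₁ * p.2)) := Real.Gamma_pos_of_pos (by positivity)
    have q2 : 0 < Real.Gamma (γ₂ + (α₂ * p.1)) := Real.Gamma_pos_of_pos (by positivity)
    have q3 : 0 < Real.Gamma (δ + (α₃ * p.1 + β₂ * p.2)) := Real.Gamma_pos_of_pos (by positivity)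
    have q4 : 0 < Real.Gamma (δ₂ + α₄ * p.1) := Real.Gamma_pos_of_pos (by positivity)
    have q5 : 0 < Real.Gamma (δ₃ + β₃ * p.2) := Real.Gamma_pos_of_pos (by positivity)
    have p10 : 0 ≤ genPoch γ₁ (α₁ * p.1 + β₁ * p.2) := by unfold genPoch; positivity
    have p20 : 0 ≤ genPoch γ₂ (α₂ * p.1) := by unfold genPoch; positivity
    simp only [hc, hrdef, norm_mul, norm_div, norm_pow, Complex.norm_real]
    rw [Real.norm_of_nonneg p10, Real.norm_of_nonneg p20, Real.norm_of_nonneg q4.le,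
      Real.norm_of_nonneg q5.le, Real.rpow_add ht, Real.rpow_mul ht.le, Real.rpow_mul ht.le,
      Real.rpow_natCast, Real.rpow_natCast, mul_pow, mul_pow]
    field_simp
  have hK : ∀ δ η : ℝ, 0 < η → ((η ^ (δ - 1) : ℝ) : ℂ) *
        E2 γ₁ α₁ β₁ γ₂ α₂ δ α₃ β₂ δ₂ α₄ δ₃ β₃
          (ω₁ * ((η ^ α₃ : ℝ) : ℂ)) (ω₂ * ((η ^ β₂ : ℝ) : ℂ)) = KK c r δ η := by
    intro δ η hη
    unfold E2 KK
    rw [← tsum_mul_left]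
    congr 1
    ext p
    simp only [hc, hrdef]
    rw [show δ + (α₃ * p.1 + β₂ * p.2) - 1 = (δ - 1) + (α₃ * p.1 + β₂ * p.2) by ring,
      Real.rpow_add hη, Real.rpow_add hη, Real.rpow_mul hη.le, Real.rpow_mul hη.le,
      Real.rpow_natCast, Real.rpow_natCast, ← add_assoc]
    push_cast
    simp only [div_eq_mul_inv, mul_inv, mul_pow]
    ring
  -- the data
  set g : ℝ → ℂ := fun x => ((f x : ℝ) : ℂ) with hg
  have hgc : ContinuousOn g (Set.Icc 0 T) := Complex.continuous_ofReal.comp_continuousOn hf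
  have hgi : IntegrableOn g (Set.Ioc 0 T) :=
    (hgc.integrableOn_Icc).mono_set Set.Ioc_subset_Icc_self
  obtain ⟨C, hC⟩ := isCompact_Icc.exists_bound_of_continuousOn hgc
  have hC' : ∀ x ∈ Set.Ioc 0 T, ‖g x‖ ≤ C := fun x hx => hC x (Set.Ioc_subset_Icc_self hx)
  have hC0 : 0 ≤ C := (norm_nonneg _).trans (hC 0 ⟨le_rfl, hT.le⟩)
  set G : ℝ → ℂ := fun ξ => ∫ u in Set.Ioc 0 ξ, KK c r (δ₁ - 1) u * g (ξ - u) with hG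
  have hGi : IntegrableOn G (Set.Ioc 0 T) := conv_integrable_trunc _ _
    (KK_integrable c r hr hS (by linarith) hT) hgi
  have hconv : ∀ δ s : ℝ, 0 < s → ∫ η in (0:ℝ)..s, ((η ^ (δ - 1) : ℝ) : ℂ) *
        E2 γ₁ α₁ β₁ γ₂ α₂ δ α₃ β₂ δ₂ α₄ δ₃ β₃
          (ω₁ * ((η ^ α₃ : ℝ) : ℂ)) (ω₂ * ((η ^ β₂ : ℝ) : ℂ)) *
        ((f (s - η) : ℝ) : ℂ) = ∫ η in (0:ℝ)..s, KK c r δ η * g (s - η) := by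
    intro δ s hs
    rw [intervalIntegral.integral_of_le hs.le, intervalIntegral.integral_of_le hs.le]
    apply setIntegral_congr_fun measurableSet_Ioc
    intro η hη
    simp only [hg]
    rw [hK δ η hη.1]
  have hF : ∀ s : ℝ, 0 < s → s ≤ T → ∫ η in (0:ℝ)..s, ((η ^ (δ₁ - 1) : ℝ) : ℂ) *
        E2 γ₁ α₁ β₁ γ₂ α₂ δ₁ α₃ β₂ δ₂ α₄ δ₃ β₃
          (ω₁ * ((η ^ α₃ : ℝ) : ℂ)) (ω₂ * ((η ^ β₂ : ℝ) : ℂ)) *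
        ((f (s - η) : ℝ) : ℂ) = ∫ ξ in (0:ℝ)..s, G ξ := by
    intro s hs hsT
    rw [hconv δ₁ s hs]
    have h := conv_KK c r hr hS (δ := δ₁ - 1) (μ := 1) (by linarith) one_pos hs hsT g hgi C hC' hC0
    simp only [sub_self, Real.rpow_zero, Complex.ofReal_one, one_mul, Real.Gamma_one,
      sub_add_cancel] at h
    exact h.symm
  have hGI : IntervalIntegrable G volume 0 T :=
    (intervalIntegrable_iff_integrableOn_Ioc_of_le hT.le).2 hGi
  have hae := hGI.ae_hasDerivAt_integral
  unfold caputoC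
  have hfin := conv_KK c r hr hS (δ := δ₁ - 1) (μ := 1 - α) (by linarith) (by linarith) ht htT g
    hgi C hC' hC0
  rw [show δ₁ - 1 + (1 - α) = δ₁ - α by ring, show 1 - α - 1 = -α by ring] at hfin
  have hGa : 0 < Real.Gamma (1 - α) := Real.Gamma_pos_of_pos (by linarith)
  rw [hconv (δ₁ - α) t ht]
  have hint : ∫ ξ in (0:ℝ)..t, ((t - ξ) ^ (-α) : ℝ) • deriv (fun s => ∫ η in (0:ℝ)..s,
        ((η ^ (δ₁ - 1) : ℝ) : ℂ) *
        E2 γ₁ α₁ β₁ γ₂ α₂ δ₁ α₃ β₂ δ₂ α₄ δ₃ β₃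
          (ω₁ * ((η ^ α₃ : ℝ) : ℂ)) (ω₂ * ((η ^ β₂ : ℝ) : ℂ)) *
        ((f (s - η) : ℝ) : ℂ)) ξ = ∫ ξ in (0:ℝ)..t, (((t - ξ) ^ (-α) : ℝ) : ℂ) * G ξ := by
    apply intervalIntegral.integral_congr_ae
    have hne : ∀ᵐ x : ℝ, x ≠ T := by simp [ae_iff, measure_singleton]
    filter_upwards [hae, hne] with x hx hxT hxm
    rw [Set.uIoc_of_le ht.le] at hxm
    have hx0 : 0 < x := hxm.1
    have hxT' : x < T := lt_of_le_of_ne (hxm.2.trans htT) hxT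
    have hd := hx (by rw [Set.uIcc_of_le hT.le]; exact ⟨hx0.le, hxT'.le⟩) 0
      (by rw [Set.uIcc_of_le hT.le]; exact ⟨le_rfl, hT.le⟩)
    have hev : (fun s => ∫ η in (0:ℝ)..s,
        ((η ^ (δ₁ - 1) : ℝ) : ℂ) *
        E2 γ₁ α₁ β₁ γ₂ α₂ δ₁ α₃ β₂ δ₂ α₄ δ₃ β₃
          (ω₁ * ((η ^ α₃ : ℝ) : ℂ)) (ω₂ * ((η ^ β₂ : ℝ) : ℂ)) *
        ((f (s - η) : ℝ) : ℂ)) =ᶠ[nhds x] fun s => ∫ ξ in (0:ℝ)..s, G ξ := by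
      filter_upwards [Ioo_mem_nhds hx0 hxT'] with s hs
      exact hF s hs.1 hs.2.le
    rw [hev.deriv_eq, hd.deriv, Complex.real_smul]
  rw [hint, hfin, Complex.real_smul, ← mul_assoc, ← Complex.ofReal_mul, one_div,
    inv_mul_cancel₀ hGa.ne', Complex.ofReal_one, one_mul]
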